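/- Let t ≥ 20 be an integer and let T be a tight 3-tree with t edges and c(T) ≤ 2. If G is a 3-graph that does not contain a copy of T, then e(G) ≤ ((t−1)/3)·|∂(G)|, where e(G) is the number of edges of G and ∂(G) is the shadow of G. -/

import Mathlib

open Finset

variable {V : Type*}

/-- The number of edges of `G` containing the vertex set `D`. -/
def degree [DecidableEq V] (G : Finset (Finset V)) (D : Finset V) : ℕ :=
  (G.filter fun e => D ⊆ e).card

/-- The shadow of an `r`-graph `G`: all `(r-1)`-element sets contained in some edge. -/
def hshadow [DecidableEq V] (G : Finset (Finset V)) (r : ℕ) : Finset (Finset V) :=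
  G.biUnion fun e => e.powersetCard (r - 1)

/-- The default weight of an edge `e` of an `r`-graph `G`. -/
noncomputable def weight [DecidableEq V] (G : Finset (Finset V)) (r : ℕ) (e : Finset V) : ℝ :=
  ∑ D ∈ e.powersetCard (r - 1), (1 : ℝ) / (degree G D : ℝ)

/-- `e 0, e 1, …, e (t-1)` is a proper ordering of the edges of the tight `r`-tree `T`. -/
def IsTightTreeOrdering [DecidableEq V] (r : ℕ) (T : Finset (Finset V))
    (e : ℕ → Finset V) (t : ℕ) : Prop :=
  T = (Finset.range t).image e ∧
  (∀ i < t, (e i).card = r) ∧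
  ∀ i, 0 < i → i < t →
    ∃ v ∈ e i, (∀ j < i, v ∉ e j) ∧ ∃ j < i, (e i).erase v ⊆ e j

/-- `T` is a tight `r`-tree. -/
def IsTightTree [DecidableEq V] (r : ℕ) (T : Finset (Finset V)) : Prop :=
  ∃ e t, IsTightTreeOrdering r T e t

/-- A leaf of `T` is a vertex of degree one. -/
def IsLeaf [DecidableEq V] (T : Finset (Finset V)) (v : V) : Prop :=
  (T.filter fun g => v ∈ g).card = 1

/-- `T'` is a trunk of the tight `r`-tree `T`: in some proper ordering of the edges of `T`
the edges of `T'` come first, and all vertices of `T` outside `T'` are leaves of `T`. -/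
def IsTrunk [DecidableEq V] (r : ℕ) (T T' : Finset (Finset V)) : Prop :=
  ∃ e t t', t' ≤ t ∧ IsTightTreeOrdering r T e t ∧
    T' = (Finset.range t').image e ∧
    ∀ v ∈ T.biUnion id, v ∉ T'.biUnion id → IsLeaf T v

/-- `G` contains a copy of `T`: an injection of the vertex set of `T` into the vertices of `G`
mapping edges of `T` to edges of `G`. -/
def ContainsCopy {W : Type*} [DecidableEq V] [DecidableEq W]
    (G : Finset (Finset W)) (T : Finset (Finset V)) : Prop :=
  ∃ f : V → W, Set.InjOn f ↑(T.biUnion id) ∧ ∀ g ∈ T, g.image f ∈ G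

/-- Given a set `S = {a,b,c,d}`, `dprime G S x y` is the number of vertices `z ∉ S`
with `{x,y,z}` an edge of `G`. -/
def dprime [Fintype V] [DecidableEq V] (G : Finset (Finset V)) (S : Finset V) (x y : V) : ℕ :=
  (Finset.univ.filter fun z => z ∉ S ∧ ({x, y, z} : Finset V) ∈ G).card

/-- The minimum codegree over the pairs of vertices contained in the edge `e`. -/
noncomputable def dmin [DecidableEq V] (G : Finset (Finset V)) (e : Finset V) : ℕ :=
  sInf {k | ∃ D ⊆ e, D.card = 2 ∧ degree G D = k}

/-- The neighbourhood `N_G(B)`: all vertices `z ∉ B` with `B ∪ {z}` an edge. -/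
def nbr [Fintype V] [DecidableEq V] (G : Finset (Finset V)) (B : Finset V) : Finset V :=
  Finset.univ.filter fun z => z ∉ B ∧ insert z B ∈ G


/-- The vertices completing the pair `x`, `y` to an edge of `G`. -/
def link {W : Type*} [DecidableEq W] (G : Finset (Finset W)) (x y : W) : Finset W :=
  (G.biUnion id).filter fun w => ({x, y, w} : Finset W) ∈ G

/-- Demands `p` can be served greedily, in the order given by a rank function, from five sets
of sizes `s`. -/
def Fits (p s : Fin 5 → ℕ) : Prop :=
  ∃ r : Fin 5 → ℕ, ∀ j, ∑ i with r i ≤ r j, p i ≤ s j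

/-- The sizes, outside `{x, y, z, u}`, of the links of the five pairs contained in one of the
edges `{x, y, z}` and `{x, y, u}`. -/
def linkSizes {W : Type*} [DecidableEq W] (G : Finset (Finset W)) (x y z u : W) : Fin 5 → ℕ :=
  ![(link G x y \ {x, y, z, u}).card, (link G x z \ {x, y, z, u}).card,
    (link G y z \ {x, y, z, u}).card, (link G x u \ {x, y, z, u}).card,
    (link G y u \ {x, y, z, u}).card]

/-- No two edges of `G` sharing a pair can be greedily extended to a tree whose trunk has two
edges and whose leaves are distributed as prescribed by `p`. -/
def Avoids {W : Type*} [DecidableEq W] (G : Finset (Finset W)) (p : Fin 5 → ℕ) : Prop :=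
  ∀ x y z u : W, x ≠ y → x ≠ z → y ≠ z → x ≠ u → y ≠ u → z ≠ u →
    {x, y, z} ∈ G → {x, y, u} ∈ G → ¬ Fits p (linkSizes G x y z u)

lemma exists_injective_of_rank {ι W : Type*} [Fintype ι] [DecidableEq W] (cl : ι → Fin 5)
    (A : Fin 5 → Finset W)
    (h : Fits (fun j => (univ.filter fun i => cl i = j).card) fun j => (A j).card) :
    ∃ φ : ι → W, Function.Injective φ ∧ ∀ i, φ i ∈ A (cl i) := by
  classical
  obtain ⟨r, hr⟩ := h
  refine (Finset.all_card_le_biUnion_card_iff_exists_injective fun i => A (cl i)).1 fun s => ?_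
  rcases s.eq_empty_or_nonempty with rfl | hs
  · simp
  obtain ⟨i, his, hi⟩ := s.exists_max_image (fun i => r (cl i)) hs
  calc s.card ≤ (univ.filter fun i' => r (cl i') ≤ r (cl i)).card :=
        card_le_card fun i' hi' => by simpa using hi i' hi'
    _ = ∑ j with r j ≤ r (cl i), (univ.filter fun i' => cl i' = j).card := by
        rw [card_eq_sum_card_fiberwise (f := cl) (t := univ.filter fun j => r j ≤ r (cl i))]
        · refine sum_congr rfl fun j hj => ?_
          congr 1
          ext i'
          simp only [mem_filter, mem_univ, true_and] at hj ⊢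
          constructor
          · exact fun h => h.2
          · rintro rfl
            exact ⟨hj, rfl⟩
        · intro i' hi'
          simpa using hi'
    _ ≤ (A (cl i)).card := hr _
    _ ≤ _ := card_le_card (subset_biUnion_of_mem (fun i => A (cl i)) his)

lemma exists_trunk_structure {V : Type*} [DecidableEq V] (n : ℕ) (T : Finset (Finset V))
    (hTn : T.card = n + 2) (hc : ∃ T', IsTrunk 3 T T' ∧ T'.card ≤ 2) :
    ∃ (a b c d : V) (v : Fin n → V) (cl : Fin n → Fin 5),
      a ≠ b ∧ a ≠ c ∧ b ≠ c ∧ a ≠ d ∧ b ≠ d ∧ c ≠ d ∧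
      Function.Injective v ∧ (∀ i, v i ∉ ({a, b, c, d} : Finset V)) ∧
      ∀ g ∈ T, g = {a, b, c} ∨ g = {a, b, d} ∨ ∃ i,
        g = insert (v i) ((![{a, b}, {a, c}, {b, c}, {a, d}, {b, d}] : Fin 5 → Finset V) (cl i)) := by
  obtain ⟨T', ⟨e, t, t', htt, ⟨hTe, hcard, hord⟩, hT', hleaf⟩, hT'2⟩ := hc
  have hinj : ∀ i < t, ∀ j < i, e i ≠ e j := by
    intro i hi j hj heq
    obtain ⟨w, hw, hnew, -⟩ := hord i (by omega) hi
    exact hnew j hj (heq ▸ hw)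
  have hinjOn : Set.InjOn e (Finset.range t) := by
    intro i hi j hj hij
    simp only [coe_range, Set.mem_Iio] at hi hj
    rcases lt_trichotomy i j with h | h | h
    · exact absurd hij.symm (hinj j hj i h)
    · exact h
    · exact absurd hij (hinj i hi j h)
  have htn : t = n + 2 := by
    rw [← hTn, hTe, card_image_of_injOn hinjOn, card_range]
  have ht'2 : t' ≤ 2 := by
    rw [hT', card_image_of_injOn (hinjOn.mono (by simpa using htt)), card_range] at hT'2
    exact hT'2
  subst htn
  -- a vertex outside the first two edges lies in exactly one edge
  have hone : ∀ w, w ∉ e 0 → w ∉ e 1 → ∀ i < n + 2, ∀ j < n + 2, w ∈ e i → w ∈ e j → i = j := by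
    intro w h0 h1 i hi j hj hwi hwj
    have hmem : ∀ i < n + 2, e i ∈ T := fun i hi => by
      rw [hTe]; exact mem_image_of_mem e (by simpa using hi)
    have hl : IsLeaf T w := by
      refine hleaf w (mem_biUnion.2 ⟨e i, hmem i hi, hwi⟩) ?_
      rw [hT']
      simp only [mem_biUnion, mem_image, mem_range, id, not_exists, not_and]
      rintro g ⟨l, hl, rfl⟩
      interval_cases t'
      · omega
      · obtain rfl : l = 0 := by omega
        exact h0
      · interval_cases l
        · exact h0
        · exact h1
    obtain ⟨g, hg⟩ := card_eq_one.1 hl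
    have hi' : e i ∈ ({g} : Finset (Finset V)) := hg ▸ mem_filter.2 ⟨hmem i hi, hwi⟩
    have hj' : e j ∈ ({g} : Finset (Finset V)) := hg ▸ mem_filter.2 ⟨hmem j hj, hwj⟩
    rw [mem_singleton] at hi' hj'
    exact hinjOn (by simpa using hi) (by simpa using hj) (hi'.trans hj'.symm)
  have : Nonempty V := ⟨(hord 1 (by omega) (by omega)).choose⟩
  choose! w hw hwnew j hj hsub using hord
  -- the remaining pair of each edge lies in one of the first two edges
  have hpair : ∀ i, 2 ≤ i → i < n + 2 → (e i).erase (w i) ⊆ e 0 ∨ (e i).erase (w i) ⊆ e 1 := by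
    intro i
    induction i using Nat.strong_induction_on with
    | _ i ih =>
      intro h2 hi
      have hj1 := hj i (by omega) hi
      have hs := hsub i (by omega) hi
      by_cases hj2 : 2 ≤ j i
      · have hs' : (e i).erase (w i) ⊆ (e (j i)).erase (w (j i)) := by
          intro y hy
          refine mem_erase.2 ⟨?_, hs hy⟩
          rintro rfl
          have := hone (w (j i)) (hwnew (j i) (by omega) (by omega) 0 (by omega))
            (hwnew (j i) (by omega) (by omega) 1 (by omega)) i hi (j i) (by omega)
            (mem_of_mem_erase hy) (hs hy)
          omega
        exact (ih (j i) hj1 hj2 (by omega)).imp hs'.trans hs'.trans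
      · have : j i = 0 ∨ j i = 1 := by omega
        rcases this with h | h
        · left; rwa [h] at hs
        · right; rwa [h] at hs
  -- the first two edges
  have hd1 : w 1 ∈ e 1 := hw 1 (by omega) (by omega)
  have hd0 : w 1 ∉ e 0 := hwnew 1 (by omega) (by omega) 0 (by omega)
  have hc2 : ((e 1).erase (w 1)).card = 2 := by
    rw [card_erase_of_mem hd1, hcard 1 (by omega)]
  have hab0 : (e 1).erase (w 1) ⊆ e 0 := by
    have := hsub 1 (by omega) (by omega)
    have h0 : j 1 = 0 := by have := hj 1 (by omega) (by omega); omega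
    rwa [h0] at this
  obtain ⟨a, b, hab, he1⟩ := card_eq_two.1 hc2
  have hc1 : (e 0 \ {a, b}).card = 1 := by
    rw [card_sdiff_of_subset (he1 ▸ hab0), hcard 0 (by omega), card_pair hab]
  obtain ⟨c, hc⟩ := card_eq_one.1 hc1
  have hcm : c ∈ e 0 \ {a, b} := hc ▸ mem_singleton_self c
  simp only [mem_sdiff, mem_insert, mem_singleton, not_or] at hcm
  have he0' : e 0 = {a, b, c} := by
    have := sdiff_union_of_subset (he1 ▸ hab0)
    rw [← this, hc]
    ext y; simp; tauto
  have he1' : e 1 = {a, b, w 1} := by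
    rw [← insert_erase hd1, he1]
    ext y; simp; tauto
  have had : a ≠ w 1 := by rintro h; exact hd0 (by rw [← h, he0']; simp)
  have hbd : b ≠ w 1 := by rintro h; exact hd0 (by rw [← h, he0']; simp)
  have hcd : c ≠ w 1 := by rintro h; exact hd0 (by rw [← h, he0']; simp)
  set d := w 1 with hd
  have hcls : ∀ i : Fin n, ∃ k : Fin 5, (e (i + 2)).erase (w (i + 2)) =
      (![{a, b}, {a, c}, {b, c}, {a, d}, {b, d}] : Fin 5 → Finset V) k := by
    intro i
    have h2 : ((e (i + 2)).erase (w (i + 2))).card = 2 := by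
      rw [card_erase_of_mem (hw _ (by omega) (by omega)), hcard _ (by omega)]
    obtain ⟨p, q, hpq, hE⟩ := card_eq_two.1 h2
    have := hpair (i + 2) (by omega) (by omega)
    rw [hE, he0', he1'] at this
    rw [hE]
    simp only [insert_subset_iff, singleton_subset_iff, mem_insert, mem_singleton] at this
    have key : ({p, q} : Finset V) = {a, b} ∨ ({p, q} : Finset V) = {a, c} ∨
        ({p, q} : Finset V) = {b, c} ∨ ({p, q} : Finset V) = {a, d} ∨
        ({p, q} : Finset V) = {b, d} := by
      rcases this with ⟨h1 | h1 | h1, h2 | h2 | h2⟩ | ⟨h1 | h1 | h1, h2 | h2 | h2⟩ <;>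
        subst h1 <;> first | exact absurd h2.symm hpq | (subst h2; simp [pair_comm])
    rcases key with h | h | h | h | h
    exacts [⟨0, h⟩, ⟨1, h⟩, ⟨2, h⟩, ⟨3, h⟩, ⟨4, h⟩]
  choose cl hcl using hcls
  refine ⟨a, b, c, d, fun i => w (i + 2), cl, hab, fun h => hcm.2.1 h.symm,
    fun h => hcm.2.2 h.symm, had, hbd, hcd, ?_, ?_, ?_⟩
  · intro i i' h
    have hn : ∀ i : Fin n, w (i + 2) ∉ e 0 ∧ w (i + 2) ∉ e 1 := fun i =>
      ⟨hwnew _ (by omega) (by omega) 0 (by omega), hwnew _ (by omega) (by omega) 1 (by omega)⟩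
    have := hone _ (hn i).1 (hn i).2 (i + 2) (by omega) (i' + 2) (by omega)
      (hw _ (by omega) (by omega)) (by
        have h' : w (i + 2) = w (i' + 2) := h
        rw [h']; exact hw _ (by omega) (by omega))
    exact Fin.ext (by omega)
  · intro i hi
    have h0 := hwnew (i + 2) (by omega) (by omega) 0 (by omega)
    have h1 := hwnew (i + 2) (by omega) (by omega) 1 (by omega)
    rw [he0'] at h0
    rw [he1'] at h1
    simp only [mem_insert, mem_singleton] at h0 h1 hi
    tauto
  · intro g hg
    rw [hTe] at hg
    obtain ⟨i, hi, rfl⟩ := mem_image.1 hg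
    rw [mem_range] at hi
    rcases Nat.lt_or_ge i 2 with h | h
    · interval_cases i
      · exact Or.inl he0'
      · exact Or.inr (Or.inl he1')
    · refine Or.inr (Or.inr ⟨⟨i - 2, by omega⟩, ?_⟩)
      have hi2 : i - 2 + 2 = i := by omega
      rw [← hcl]
      simp only [hi2]
      exact (insert_erase (hw i (by omega) hi)).symm

lemma exists_avoids {V : Type*} [DecidableEq V] (n : ℕ) (T : Finset (Finset V))
    (hTn : T.card = n + 2) (hc : ∃ T', IsTrunk 3 T T' ∧ T'.card ≤ 2) :
    ∃ p : Fin 5 → ℕ, ∑ i, p i = n ∧ ∀ {W : Type*} [DecidableEq W] (G : Finset (Finset W)),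
      ¬ ContainsCopy G T → Avoids G p := by
  classical
  obtain ⟨a, b, c, d, v, cl, hab, hac, hbc, had, hbd, hcd, hv, hvn, hT⟩ :=
    exists_trunk_structure n T hTn hc
  refine ⟨fun j => (univ.filter fun i => cl i = j).card, ?_, ?_⟩
  · rw [← card_eq_sum_card_fiberwise (f := cl) (s := univ) (t := univ) (by simp)]
    simp
  intro W _ G hG x y z u hxy hxz hyz hxu hyu hzu hxyz hxyu hfit
  set S : Finset W := {x, y, z, u} with hS
  obtain ⟨φ, hφ, hφm⟩ := exists_injective_of_rank cl
    ![link G x y \ S, link G x z \ S, link G y z \ S, link G x u \ S, link G y u \ S] (by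
      convert hfit using 2 with j
      fin_cases j <;> rfl)
  have hφS : ∀ i, φ i ∉ S := by
    intro i
    have := hφm i
    generalize cl i = k at this
    fin_cases k <;> exact (mem_sdiff.1 this).2
  refine hG ?_
  let f : V → W := fun w => if w = a then x else if w = b then y else if w = c then z else
    if w = d then u else if h : ∃ i, v i = w then φ h.choose else x
  have fa : f a = x := by simp [f]
  have fb : f b = y := by simp [f, hab.symm]
  have fc : f c = z := by simp [f, hac.symm, hbc.symm]
  have fd : f d = u := by simp [f, had.symm, hbd.symm, hcd.symm]
  have fv : ∀ i, f (v i) = φ i := by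
    intro i
    have := hvn i
    simp only [mem_insert, mem_singleton, not_or] at this
    have h : ∃ i', v i' = v i := ⟨i, rfl⟩
    simp only [f, this, if_false, dif_pos h]
    exact congrArg φ (hv h.choose_spec)
  have hmem : ∀ w ∈ T.biUnion id, w = a ∨ w = b ∨ w = c ∨ w = d ∨ ∃ i, w = v i := by
    intro w hw
    obtain ⟨g, hg, hwg⟩ := mem_biUnion.1 hw
    rcases hT g hg with rfl | rfl | ⟨i, rfl⟩
    · simp at hwg; tauto
    · simp at hwg; tauto
    · generalize cl i = k at hwg
      simp only [id, mem_insert] at hwg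
      rcases hwg with h | h
      · exact Or.inr (Or.inr (Or.inr (Or.inr ⟨i, h⟩)))
      · fin_cases k <;> simp at h <;> tauto
  refine ⟨f, ?_, ?_⟩
  · have hS' : ∀ i, φ i ≠ x ∧ φ i ≠ y ∧ φ i ≠ z ∧ φ i ≠ u := by
      intro i
      have := hφS i
      simp only [hS, mem_insert, mem_singleton, not_or] at this
      exact this
    intro w hw w' hw' hww
    rcases hmem w hw with rfl | rfl | rfl | rfl | ⟨i, rfl⟩ <;>
    rcases hmem w' hw' with rfl | rfl | rfl | rfl | ⟨i', rfl⟩ <;>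
    simp only [fa, fb, fc, fd, fv] at hww <;>
    first
      | rfl
      | exact absurd hww (by assumption)
      | exact absurd hww.symm (by assumption)
      | exact absurd hww (hS' _).1
      | exact absurd hww (hS' _).2.1
      | exact absurd hww (hS' _).2.2.1
      | exact absurd hww (hS' _).2.2.2
      | exact absurd hww.symm (hS' _).1
      | exact absurd hww.symm (hS' _).2.1
      | exact absurd hww.symm (hS' _).2.2.1
      | exact absurd hww.symm (hS' _).2.2.2
      | exact congrArg v (hφ hww)
  · intro g hg
    rcases hT g hg with rfl | rfl | ⟨i, rfl⟩
    · simpa [image_insert, fa, fb, fc] using hxyz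
    · simpa [image_insert, fa, fb, fd] using hxyu
    · have hm := hφm i
      have hl : ∀ {x' y' : W}, φ i ∈ link G x' y' \ S → ({φ i, x', y'} : Finset W) ∈ G := by
        intro x' y' h
        have := (mem_filter.1 (mem_sdiff.1 h).1).2
        convert this using 1
        ext; simp; tauto
      generalize cl i = k at hm ⊢
      fin_cases k <;> simpa [image_insert, fa, fb, fc, fd, fv] using hl hm

lemma fits_of_chain {p s : Fin 5 → ℕ} (i₁ i₂ i₃ i₄ i₅ : Fin 5)
    (hi : ∀ j, j = i₁ ∨ j = i₂ ∨ j = i₃ ∨ j = i₄ ∨ j = i₅)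
    (h₁ : p i₁ ≤ s i₁) (h₂ : p i₁ + p i₂ ≤ s i₂) (h₃ : p i₁ + p i₂ + p i₃ ≤ s i₃)
    (h₄ : p i₁ + p i₂ + p i₃ + p i₄ ≤ s i₄)
    (h₅ : p i₁ + p i₂ + p i₃ + p i₄ + p i₅ ≤ s i₅) : Fits p s := by
  have hsum : ∀ (A : Finset (Fin 5)) (l : List (Fin 5)), (∀ i ∈ A, i ∈ l) →
      ∑ i ∈ A, p i ≤ (l.map p).sum := by
    intro A l
    induction l generalizing A with
    | nil =>
      intro h
      obtain rfl : A = ∅ := Finset.eq_empty_of_forall_notMem fun i hi => by simpa using h i hi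
      simp
    | cons a l ih =>
      intro h
      calc ∑ i ∈ A, p i ≤ ∑ i ∈ insert a (A.erase a), p i :=
            sum_le_sum_of_subset (by intro i; by_cases i = a <;> simp_all)
        _ = p a + ∑ i ∈ A.erase a, p i := sum_insert (by simp)
        _ ≤ p a + (l.map p).sum := by
            gcongr
            refine ih _ fun i hi => ?_
            have := h i (mem_of_mem_erase hi)
            simp only [List.mem_cons] at this
            exact this.resolve_left (ne_of_mem_erase hi)
        _ = _ := by simp
  refine ⟨fun j => if j = i₁ then 0 else if j = i₂ then 1 else if j = i₃ then 2 else
    if j = i₄ then 3 else 4, fun j => ?_⟩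
  by_cases e₁ : j = i₁
  · refine (hsum _ [i₁] ?_).trans (by subst e₁; simpa using h₁)
    intro i; simp [e₁]; split_ifs <;> simp_all
  by_cases e₂ : j = i₂
  · refine (hsum _ [i₁, i₂] ?_).trans (by subst e₂; simpa using h₂)
    intro i; simp only [mem_filter, mem_univ, true_and, if_neg e₁, if_pos e₂]
    split_ifs <;> simp_all
  by_cases e₃ : j = i₃
  · refine (hsum _ [i₁, i₂, i₃] ?_).trans (by subst e₃; simpa [add_assoc] using h₃)
    intro i; simp only [mem_filter, mem_univ, true_and, if_neg e₁, if_neg e₂, if_pos e₃]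
    split_ifs <;> simp_all
  by_cases e₄ : j = i₄
  · refine (hsum _ [i₁, i₂, i₃, i₄] ?_).trans (by subst e₄; simpa [add_assoc] using h₄)
    intro i
    simp only [mem_filter, mem_univ, true_and, if_neg e₁, if_neg e₂, if_neg e₃, if_pos e₄]
    split_ifs <;> simp_all
  have e₅ : j = i₅ := by have := hi j; tauto
  refine (hsum _ [i₁, i₂, i₃, i₄, i₅] ?_).trans (by subst e₅; simpa [add_assoc] using h₅)
  intro i _
  simpa using hi i

section Placement

variable {K : ℕ → ℕ → ℕ → ℕ → Prop}
  (hxy : ∀ a b c d, K a b c d → K b a d c) (hzu : ∀ a b c d, K a b c d → K c d a b)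

include hxy hzu

lemma exists_placement_snd_max {a b c d : ℕ} (h : K a b c d) :
    ∃ a' b' c' d', K a' b' c' d' ∧ a' + b' + c' + d' = a + b + c + d ∧
      a' ≤ b' ∧ c' ≤ b' ∧ d' ≤ b' := by
  by_cases h₁ : b ≤ a ∧ c ≤ a ∧ d ≤ a
  · exact ⟨b, a, d, c, hxy _ _ _ _ h, by omega, by omega, by omega, by omega⟩
  by_cases h₂ : a ≤ b ∧ c ≤ b ∧ d ≤ b
  · exact ⟨a, b, c, d, h, by omega, by omega, by omega, by omega⟩
  by_cases h₃ : a ≤ c ∧ b ≤ c ∧ d ≤ c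
  · exact ⟨d, c, b, a, hxy _ _ _ _ (hzu _ _ _ _ h), by omega, by omega, by omega, by omega⟩
  · exact ⟨c, d, a, b, hzu _ _ _ _ h, by omega, by omega, by omega, by omega⟩

lemma exists_placement_top {a b c d : ℕ} (h : K a b c d) :
    ∃ a' b' c' d', K a' b' c' d' ∧ a' + b' + c' + d' = a + b + c + d ∧
      c' + d' ≤ a' + b' ∧ c' ≤ d' := by
  by_cases h₁ : c + d ≤ a + b <;> by_cases h₂ : c ≤ d
  · exact ⟨a, b, c, d, h, by omega, by omega, by omega⟩
  · exact ⟨b, a, d, c, hxy _ _ _ _ h, by omega, by omega, by omega⟩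
  all_goals by_cases h₃ : a ≤ b
  all_goals first
    | exact ⟨c, d, a, b, hzu _ _ _ _ h, by omega, by omega, by omega⟩
    | exact ⟨d, c, b, a, hxy _ _ _ _ (hzu _ _ _ _ h), by omega, by omega, by omega⟩

lemma exists_placement_side {a b c d : ℕ} (h : K a b c d) :
    ∃ a' b' c' d', K a' b' c' d' ∧ a' + b' + c' + d' = a + b + c + d ∧
      a' + c' ≤ b' + d' ∧ c' ≤ a' := by
  by_cases h₁ : a + c ≤ b + d
  · by_cases h₂ : c ≤ a
    · exact ⟨a, b, c, d, h, by omega, by omega, by omega⟩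
    · exact ⟨c, d, a, b, hzu _ _ _ _ h, by omega, by omega, by omega⟩
  · by_cases h₂ : d ≤ b
    · exact ⟨b, a, d, c, hxy _ _ _ _ h, by omega, by omega, by omega⟩
    · exact ⟨d, c, b, a, hxy _ _ _ _ (hzu _ _ _ _ h), by omega, by omega, by omega⟩

lemma exists_placement_cross {a b c d : ℕ} (h : K a b c d) :
    ∃ a' b' c' d', K a' b' c' d' ∧ a' + b' + c' + d' = a + b + c + d ∧
      a' + d' ≤ b' + c' ∧ d' ≤ a' := by
  by_cases h₁ : a + d ≤ b + c
  · by_cases h₂ : d ≤ a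
    · exact ⟨a, b, c, d, h, by omega, by omega, by omega⟩
    · exact ⟨d, c, b, a, hxy _ _ _ _ (hzu _ _ _ _ h), by omega, by omega, by omega⟩
  · by_cases h₂ : c ≤ b
    · exact ⟨b, a, d, c, hxy _ _ _ _ h, by omega, by omega, by omega⟩
    · exact ⟨c, d, a, b, hzu _ _ _ _ h, by omega, by omega, by omega⟩

/-- The numerical core when the shared pair is the pair of minimum codegree `d`. -/
lemma exists_fits_of_min {k m n a b c e d d₂ g h s₀ s₁ s₂ s₃ s₄ : ℕ} (hK : K a b c e)
    (hn : a + b + c + e = n) (hk : m + n + 1 = k) (hk19 : 19 ≤ k) (hm : 3 * m ≤ k - 2)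
    (hd : m + 2 ≤ d) (hd₂ : m + n / 2 + 2 ≤ d₂) (hdd : d ≤ d₂) (hdk : k + 1 ≤ 3 * d)
    (hg : k + 1 ≤ 3 * g) (hgh : g ≤ h) (hh : 2 * (k - 3) < 3 * (h - 1))
    (hdg : 2 * (k - 3) < 3 * (d - 1) ∨ 2 * (k - 3) < 3 * (g - 1))
    (hsum : 3 * k - 5 ≤ d + g + h)
    (h₀ : d - 2 ≤ s₀) (h₁ : d₂ - 2 ≤ s₁) (h₂ : k - 1 ≤ s₂)
    (h₃₄ : g - 2 ≤ s₃ ∧ h - 2 ≤ s₄ ∨ h - 2 ≤ s₃ ∧ g - 2 ≤ s₄) :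
    ∃ a' b' c' e', K a' b' c' e' ∧ Fits ![m, a', b', c', e'] ![s₀, s₁, s₂, s₃, s₄] := by
  by_cases hd0 : k + 1 ≤ d
  · obtain ⟨a', b', c', e', hK', hs, hu, hce⟩ := exists_placement_top hxy hzu hK
    rcases h₃₄ with ⟨h₃, h₄⟩ | ⟨h₃, h₄⟩
    · refine ⟨_, _, _, _, hK', fits_of_chain 3 4 0 1 2 (by decide) ?_ ?_ ?_ ?_ ?_⟩ <;>
        simp <;> omega
    · refine ⟨_, _, _, _, hxy _ _ _ _ hK', fits_of_chain 4 3 0 1 2 (by decide) ?_ ?_ ?_ ?_ ?_⟩ <;>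
        simp <;> omega
  by_cases hh0 : k + 1 ≤ h
  · rcases h₃₄ with ⟨h₃, h₄⟩ | ⟨h₃, h₄⟩
    · obtain ⟨a', b', c', e', hK', hs, hu, hce⟩ := exists_placement_side hxy hzu hK
      by_cases hd4 : m + n / 4 + 2 ≤ d
      · refine ⟨_, _, _, _, hK', fits_of_chain 3 0 1 4 2 (by decide) ?_ ?_ ?_ ?_ ?_⟩ <;>
          simp <;> omega
      · refine ⟨_, _, _, _, hK', fits_of_chain 0 3 1 4 2 (by decide) ?_ ?_ ?_ ?_ ?_⟩ <;>
          simp <;> omega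
    · obtain ⟨a', b', c', e', hK', hs, hu, hce⟩ := exists_placement_cross hxy hzu hK
      by_cases hd4 : m + n / 4 + 2 ≤ d
      · refine ⟨_, _, _, _, hK', fits_of_chain 4 0 1 3 2 (by decide) ?_ ?_ ?_ ?_ ?_⟩ <;>
          simp <;> omega
      · refine ⟨_, _, _, _, hK', fits_of_chain 0 4 1 3 2 (by decide) ?_ ?_ ?_ ?_ ?_⟩ <;>
          simp <;> omega
  obtain ⟨a', b', c', e', hK', hs, ha, hc, he⟩ := exists_placement_snd_max hxy hzu hK
  by_cases hdg' : d ≤ g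
  · rcases h₃₄ with ⟨h₃, h₄⟩ | ⟨h₃, h₄⟩
    · refine ⟨_, _, _, _, hK', fits_of_chain 0 1 3 4 2 (by decide) ?_ ?_ ?_ ?_ ?_⟩ <;>
        simp <;> omega
    · refine ⟨_, _, _, _, hK', fits_of_chain 0 1 4 3 2 (by decide) ?_ ?_ ?_ ?_ ?_⟩ <;>
        simp <;> omega
  · rcases h₃₄ with ⟨h₃, h₄⟩ | ⟨h₃, h₄⟩
    · refine ⟨_, _, _, _, hK', fits_of_chain 3 0 1 4 2 (by decide) ?_ ?_ ?_ ?_ ?_⟩ <;>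
        simp <;> omega
    · refine ⟨_, _, _, _, hK', fits_of_chain 4 0 1 3 2 (by decide) ?_ ?_ ?_ ?_ ?_⟩ <;>
        simp <;> omega

/-- The numerical core when the shared pair is the pair of maximum codegree. -/
lemma exists_fits_of_max {k m n a b c e g h s₀ s₁ s₂ s₃ s₄ : ℕ} (hK : K a b c e)
    (hn : a + b + c + e = n) (hk : m + n + 1 = k) (hk19 : 19 ≤ k)
    (hg : k + 1 ≤ 3 * g) (hgh : g ≤ h)
    (hgn : h ≤ n + 1 → 3 * n < 4 * (g - 1)) (hnk : 3 * n + 1 ≤ 2 * k)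
    (h₀ : k - 1 ≤ s₀) (h₁ : n / 2 ≤ s₁) (h₂ : n ≤ s₂)
    (h₃₄ : g - 2 ≤ s₃ ∧ h - 2 ≤ s₄ ∨ h - 2 ≤ s₃ ∧ g - 2 ≤ s₄) :
    ∃ a' b' c' e', K a' b' c' e' ∧ Fits ![m, a', b', c', e'] ![s₀, s₁, s₂, s₃, s₄] := by
  by_cases hh0 : n + 2 ≤ h
  · rcases h₃₄ with ⟨h₃, h₄⟩ | ⟨h₃, h₄⟩
    · obtain ⟨a', b', c', e', hK', hs, hu, hce⟩ := exists_placement_side hxy hzu hK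
      refine ⟨_, _, _, _, hK', fits_of_chain 3 1 2 4 0 (by decide) ?_ ?_ ?_ ?_ ?_⟩ <;>
        simp <;> omega
    · obtain ⟨a', b', c', e', hK', hs, hu, hce⟩ := exists_placement_cross hxy hzu hK
      refine ⟨_, _, _, _, hK', fits_of_chain 4 1 2 3 0 (by decide) ?_ ?_ ?_ ?_ ?_⟩ <;>
        simp <;> omega
  obtain ⟨a', b', c', e', hK', hs, ha, hc, he⟩ := exists_placement_snd_max hxy hzu hK
  refine ⟨_, _, _, _, hK', fits_of_chain 1 3 4 2 0 (by decide) ?_ ?_ ?_ ?_ ?_⟩ <;>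
    simp <;> omega

end Placement

section Link

variable {W : Type*} [DecidableEq W] {G : Finset (Finset W)}

lemma mem_link {x y w : W} : w ∈ link G x y ↔ {x, y, w} ∈ G := by
  simp only [link, mem_filter, mem_biUnion, id, and_iff_right_iff_imp]
  exact fun h => ⟨_, h, by simp⟩

lemma link_comm (x y : W) : link G x y = link G y x := by
  ext w
  rw [mem_link, mem_link, insert_comm]

lemma ne_of_triple_mem (hG : ∀ g ∈ G, g.card = 3) {x y w : W} (h : {x, y, w} ∈ G) :
    x ≠ y ∧ x ≠ w ∧ y ≠ w := by
  have h3 := hG _ h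
  have h2 : ∀ a b : W, ({a, b} : Finset W).card ≤ 2 := fun a b => card_le_two
  refine ⟨?_, ?_, ?_⟩ <;> rintro rfl
  · have := h2 x w; simp_all
  · have := h2 x y; rw [pair_comm y x] at h3; simp_all
  · have := h2 x y; simp_all

lemma degree_pair (hG : ∀ g ∈ G, g.card = 3) {x y : W} (hxy : x ≠ y) :
    degree G {x, y} = (link G x y).card := by
  symm
  refine card_bij (fun w _ => {x, y, w}) (fun w hw => ?_) (fun w hw w' hw' h => ?_)
    (fun g hg => ?_)
  · exact mem_filter.2 ⟨mem_link.1 hw, by intro; simp; tauto⟩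
  · have h₁ := ne_of_triple_mem hG (mem_link.1 hw)
    have : w ∈ ({x, y, w'} : Finset W) := h ▸ by simp
    simp only [mem_insert, mem_singleton] at this
    tauto
  · obtain ⟨hg, hD⟩ := mem_filter.1 hg
    have hc : (g \ {x, y}).card = 1 := by
      rw [card_sdiff_of_subset hD, hG g hg, card_pair hxy]
    obtain ⟨w, hw⟩ := card_eq_one.1 hc
    have hg' : ({x, y, w} : Finset W) = g := by
      have := sdiff_union_of_subset hD
      rw [← this, hw]
      ext v; simp; tauto
    exact ⟨w, mem_link.2 (hg' ▸ hg), hg'⟩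

lemma degree_le_card_link_sdiff_add_two (hG : ∀ g ∈ G, g.card = 3) {x y a b : W} (hxy : x ≠ y)
    {S : Finset W} (hS : S ⊆ {x, y, a, b}) :
    degree G {x, y} - 2 ≤ (link G x y \ S).card := by
  rw [degree_pair hG hxy]
  have h : link G x y ⊆ (link G x y \ S) ∪ {a, b} := by
    intro w hw
    have := ne_of_triple_mem hG (mem_link.1 hw)
    have h' : w ∈ S → w ∈ ({x, y, a, b} : Finset W) := fun h => hS h
    simp only [mem_insert, mem_singleton, mem_union, mem_sdiff] at h' ⊢
    grind
  have h₁ := card_le_card h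
  have h₂ := card_union_le (link G x y \ S) {a, b}
  have h₃ : ({a, b} : Finset W).card ≤ 2 := card_le_two
  omega

lemma degree_le_card_link_sdiff_add_one (hG : ∀ g ∈ G, g.card = 3) {x y a b : W} (hxy : x ≠ y)
    {S : Finset W} (hS : S ⊆ {x, y, a, b}) (hb : b ∉ link G x y) :
    degree G {x, y} - 1 ≤ (link G x y \ S).card := by
  rw [degree_pair hG hxy]
  have h : link G x y ⊆ (link G x y \ S) ∪ {a} := by
    intro w hw
    have := ne_of_triple_mem hG (mem_link.1 hw)
    have h' : w ∈ S → w ∈ ({x, y, a, b} : Finset W) := fun h => hS h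
    simp only [mem_insert, mem_singleton, mem_union, mem_sdiff] at h' ⊢
    grind
  have h₁ := card_le_card h
  have h₂ := card_union_le (link G x y \ S) {a}
  have h₃ : ({a} : Finset W).card = 1 := card_singleton _
  omega

lemma Fits.perm {p s p' s' : Fin 5 → ℕ} (σ : Equiv.Perm (Fin 5)) (hp : p' = p ∘ σ)
    (hs : s' = s ∘ σ) (h : Fits p' s') : Fits p s := by
  subst hp hs
  obtain ⟨r, hr⟩ := h
  refine ⟨r ∘ σ.symm, fun j => ?_⟩
  convert hr (σ.symm j) using 1
  · refine sum_equiv σ.symm ?_ ?_ <;> simp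
  · simp

lemma Avoids.swap_fst_snd {m a b c d : ℕ} (h : Avoids G ![m, a, b, c, d]) :
    Avoids G ![m, b, a, d, c] := by
  intro x y z u hxy hxz hyz hxu hyu hzu h₁ h₂ hf
  refine h y x z u hxy.symm hyz hxz hyu hxu hzu (by rwa [insert_comm]) (by rwa [insert_comm])
    (hf.perm (Equiv.swap 1 2 * Equiv.swap 3 4) ?_ ?_)
  · ext j; fin_cases j <;> rfl
  · have : ({y, x, z, u} : Finset W) = {x, y, z, u} := insert_comm _ _ _
    unfold linkSizes
    rw [this, link_comm x y]
    ext j; fin_cases j <;> rfl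

lemma Avoids.swap_tips {m a b c d : ℕ} (h : Avoids G ![m, a, b, c, d]) :
    Avoids G ![m, c, d, a, b] := by
  intro x y z u hxy hxz hyz hxu hyu hzu h₁ h₂ hf
  refine h x y u z hxy hxu hyu hxz hyz hzu.symm h₂ h₁
    (hf.perm (Equiv.swap 1 3 * Equiv.swap 2 4) ?_ ?_)
  · ext j; fin_cases j <;> rfl
  · have : ({x, y, u, z} : Finset W) = {x, y, z, u} := by rw [pair_comm u z]
    unfold linkSizes
    rw [this]
    ext j; fin_cases j <;> rfl

lemma sum_powersetCard_two {M : Type*} [AddCommMonoid M] (F : Finset W → M) {x y z : W}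
    (hxy : x ≠ y) (hxz : x ≠ z) (hyz : y ≠ z) :
    ∑ D ∈ ({x, y, z} : Finset W).powersetCard 2, F D = F {x, y} + F {x, z} + F {y, z} := by
  have h₁ : ({x, y} : Finset W) ≠ {x, z} := fun h => by
    have : y ∈ ({x, z} : Finset W) := h ▸ by simp
    simp only [mem_insert, mem_singleton] at this
    tauto
  have h₂ : ({x, y} : Finset W) ≠ {y, z} := fun h => by
    have : x ∈ ({y, z} : Finset W) := h ▸ by simp
    simp only [mem_insert, mem_singleton] at this
    tauto
  have h₃ : ({x, z} : Finset W) ≠ {y, z} := fun h => by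
    have : x ∈ ({y, z} : Finset W) := h ▸ by simp
    simp only [mem_insert, mem_singleton] at this
    tauto
  have h : ({x, y, z} : Finset W).powersetCard 2 = {{x, y}, {x, z}, {y, z}} := by
    symm
    refine eq_of_subset_of_card_le ?_ ?_
    · intro D hD
      simp only [mem_insert, mem_singleton] at hD
      rw [mem_powersetCard]
      rcases hD with rfl | rfl | rfl
      · exact ⟨by intro; simp; tauto, card_pair hxy⟩
      · exact ⟨by intro; simp; tauto, card_pair hxz⟩
      · exact ⟨by intro; simp; tauto, card_pair hyz⟩
    · rw [card_powersetCard, card_eq_three.2 ⟨x, y, z, hxy, hxz, hyz, rfl⟩,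
        card_eq_three.2 ⟨_, _, _, h₁, h₂, h₃, rfl⟩]
      decide
  rw [h, sum_insert (by simp [h₁, h₂]), sum_pair h₃, add_assoc]

end Link

section Reciprocals

lemma lt_of_inv_add_inv_lt {x y κ : ℝ} (hx : 0 < x) (hxy : x ≤ y) (hκ : 0 < κ)
    (h : 1 / x + 1 / y < 3 / κ) : 2 * κ < 3 * y := by
  have h₁ : 1 / y ≤ 1 / x := one_div_le_one_div_of_le hx hxy
  have h₂ : 2 / y < 3 / κ := by
    have : 2 / y = 1 / y + 1 / y := by ring
    linarith
  rwa [div_lt_div_iff₀ (hx.trans_le hxy) hκ] at h₂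

lemma lt_add_add_of_inv_lt {x y z κ : ℝ} (hx : 0 < x) (hy : 0 < y) (hz : 0 < z) (hκ : 0 < κ)
    (h : 1 / x + 1 / y + 1 / z < 3 / κ) : 3 * κ < x + y + z := by
  have h₁ : 9 / (x + y + z) ≤ 1 / x + 1 / y + 1 / z := by
    have : 1 / x + 1 / y + 1 / z = (y * z + x * z + x * y) / (x * y * z) := by field_simp
    rw [this, div_le_div_iff₀ (by positivity) (by positivity)]
    nlinarith [mul_nonneg hx.le (sq_nonneg (y - z)), mul_nonneg hy.le (sq_nonneg (x - z)),
      mul_nonneg hz.le (sq_nonneg (x - y))]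
  have h₂ := h₁.trans_lt h
  rw [div_lt_div_iff₀ (by positivity) hκ] at h₂
  linarith

lemma codegree_bounds {k a g h : ℕ} (hk : 19 ≤ k) (ha : 2 ≤ a) (hg : 2 ≤ g) (hgh : g ≤ h)
    (hs : (1 : ℝ) / (a - 1) + 1 / (g - 1) + 1 / (h - 1) < 3 / (k - 3)) :
    2 * (k - 3) < 3 * (h - 1) ∧ (2 * (k - 3) < 3 * (a - 1) ∨ 2 * (k - 3) < 3 * (g - 1)) ∧
      3 * k - 5 ≤ a + g + h ∧
      ∀ n, 0 < n → 9 * n ≤ 7 * (k - 3) → h ≤ n + 1 → 3 * n < 4 * (g - 1) := by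
  obtain ⟨κ, rfl⟩ : ∃ κ, k = κ + 3 := ⟨k - 3, by omega⟩
  obtain ⟨a, rfl⟩ : ∃ a', a = a' + 1 := ⟨a - 1, by omega⟩
  obtain ⟨g, rfl⟩ : ∃ a', g = a' + 1 := ⟨g - 1, by omega⟩
  obtain ⟨h, rfl⟩ : ∃ a', h = a' + 1 := ⟨h - 1, by omega⟩
  push_cast at hs
  simp only [add_sub_cancel_right] at hs ⊢
  have ha' : (0 : ℝ) < a := by exact_mod_cast (by omega : 0 < a)
  have hg' : (0 : ℝ) < g := by exact_mod_cast (by omega : 0 < g)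
  have hh' : (0 : ℝ) < h := by exact_mod_cast (by omega : 0 < h)
  have hκ' : (0 : ℝ) < κ := by exact_mod_cast (by omega : 0 < κ)
  have hgh' : (g : ℝ) ≤ h := by exact_mod_cast (by omega : g ≤ h)
  have ia : 0 < 1 / (a : ℝ) := by positivity
  have ig : 0 < 1 / (g : ℝ) := by positivity
  have ih : 0 < 1 / (h : ℝ) := by positivity
  refine ⟨?_, ?_, ?_, ?_⟩
  · have := lt_of_inv_add_inv_lt hg' hgh' hκ' (by linarith)
    norm_cast at this
  · rcases le_total a g with h' | h'
    · have h'' : (a : ℝ) ≤ g := by exact_mod_cast h'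
      have := lt_of_inv_add_inv_lt ha' h'' hκ' (by linarith)
      norm_cast at this
      omega
    · have h'' : (g : ℝ) ≤ a := by exact_mod_cast h'
      have := lt_of_inv_add_inv_lt hg' h'' hκ' (by linarith)
      norm_cast at this
      omega
  · have := lt_add_add_of_inv_lt ha' hg' hh' hκ' hs
    norm_cast at this
    omega
  · intro n hn h9 hhn
    have hn' : (0 : ℝ) < n := by exact_mod_cast hn
    have h₁ : 1 / (n : ℝ) ≤ 1 / h :=
      one_div_le_one_div_of_le hh' (by exact_mod_cast (by omega : h ≤ n))
    have h₂ : 3 / (κ : ℝ) ≤ 7 / (3 * n) := by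
      rw [div_le_div_iff₀ hκ' (by positivity)]
      have : (9 * n : ℝ) ≤ 7 * κ := by exact_mod_cast (by omega : 9 * n ≤ 7 * κ)
      linarith
    have h₃ : 1 / (g : ℝ) < 4 / (3 * n) := by
      have : (4 : ℝ) / (3 * n) = 7 / (3 * n) - 1 / n := by field_simp; norm_num
      linarith
    rw [div_lt_div_iff₀ hg' (by positivity)] at h₃
    norm_cast at h₃
    omega

end Reciprocals

section Heavy

variable {W : Type*} [DecidableEq W] {G : Finset (Finset W)}

/-- The reciprocals of the codegrees minus one, summed over the pairs in `f`, are large. -/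
def Heavy (G : Finset (Finset W)) (k : ℕ) (f : Finset W) : Prop :=
  (3 : ℝ) / (k - 3) ≤ ∑ D ∈ f.powersetCard 2, (1 : ℝ) / (degree G D - 1)

noncomputable instance (k : ℕ) (f : Finset W) : Decidable (Heavy G k f) :=
  Real.decidableLE _ _

variable {k m n a b c e : ℕ} {x y z u : W}

lemma heavy_of_min (hG : ∀ g ∈ G, g.card = 3) (hav : Avoids G ![m, a, b, c, e])
    (hn : a + b + c + e = n) (hk : m + n + 1 = k) (hk19 : 19 ≤ k)
    (hmin : ∀ x y w : W, {x, y, w} ∈ G → k + 1 ≤ 3 * degree G {x, y})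
    (hz : {x, y, z} ∈ G) (hu : {x, y, u} ∈ G) (hzu : z ≠ u) (hm : 3 * m ≤ k - 2)
    (hd : m + 2 ≤ degree G {x, y}) (hd₂ : m + n / 2 + 2 ≤ degree G {x, z})
    (hdd : degree G {x, y} ≤ degree G {x, z}) (hd₃ : k + 1 ≤ degree G {y, z}) :
    Heavy G k {x, y, u} := by
  obtain ⟨hxy, hxz, hyz⟩ := ne_of_triple_mem hG hz
  obtain ⟨-, hxu, hyu⟩ := ne_of_triple_mem hG hu
  by_contra hH
  rw [Heavy, sum_powersetCard_two _ hxy hxu hyu, not_le] at hH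
  have hxu' := hmin x u y (by rwa [pair_comm])
  have hyu' := hmin y u x (by rwa [insert_comm, pair_comm x u] at hu)
  have hxy' := hmin x y u hu
  have sxy : degree G {x, y} - 2 ≤ (link G x y \ {x, y, z, u}).card :=
    degree_le_card_link_sdiff_add_two hG (a := z) (b := u) hxy (by intro; simp)
  have sxz : degree G {x, z} - 2 ≤ (link G x z \ {x, y, z, u}).card :=
    degree_le_card_link_sdiff_add_two hG (a := y) (b := u) hxz (by intro; simp; tauto)
  have syz : degree G {y, z} - 2 ≤ (link G y z \ {x, y, z, u}).card :=
    degree_le_card_link_sdiff_add_two hG (a := x) (b := u) hyz (by intro; simp; tauto)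
  have sxu : degree G {x, u} - 2 ≤ (link G x u \ {x, y, z, u}).card :=
    degree_le_card_link_sdiff_add_two hG (a := y) (b := z) hxu (by intro; simp; tauto)
  have syu : degree G {y, u} - 2 ≤ (link G y u \ {x, y, z, u}).card :=
    degree_le_card_link_sdiff_add_two hG (a := x) (b := z) hyu (by intro; simp; tauto)
  have key : ∃ a' b' c' e', Avoids G ![m, a', b', c', e'] ∧
      Fits ![m, a', b', c', e'] (linkSizes G x y z u) := by
    rcases le_total (degree G {x, u}) (degree G {y, u}) with hle | hle
    · obtain ⟨h₁, h₂, h₃, -⟩ := codegree_bounds hk19 (by omega) (by omega) hle hH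
      exact exists_fits_of_min (K := fun a b c d => Avoids G ![m, a, b, c, d])
        (fun _ _ _ _ => Avoids.swap_fst_snd) (fun _ _ _ _ => Avoids.swap_tips) hav hn hk hk19 hm
        hd hd₂ hdd hxy' hxu' hle h₁ h₂ h₃ sxy sxz (by omega) (Or.inl ⟨sxu, syu⟩)
    · rw [add_right_comm] at hH
      obtain ⟨h₁, h₂, h₃, -⟩ := codegree_bounds hk19 (by omega) (by omega) hle hH
      exact exists_fits_of_min (K := fun a b c d => Avoids G ![m, a, b, c, d])
        (fun _ _ _ _ => Avoids.swap_fst_snd) (fun _ _ _ _ => Avoids.swap_tips) hav hn hk hk19 hm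
        hd hd₂ hdd hxy' hyu' hle h₁ h₂ h₃ sxy sxz (by omega) (Or.inr ⟨sxu, syu⟩)
  obtain ⟨_, _, _, _, h₁, h₂⟩ := key
  exact h₁ x y z u hxy hxz hyz hxu hyu hzu hz hu h₂

lemma heavy_of_max (hG : ∀ g ∈ G, g.card = 3) (hav : Avoids G ![m, a, b, c, e])
    (hn : a + b + c + e = n) (hk : m + n + 1 = k) (hk19 : 19 ≤ k)
    (hmin : ∀ x y w : W, {x, y, w} ∈ G → k + 1 ≤ 3 * degree G {x, y})
    (hz : {x, y, z} ∈ G) (hu : {x, y, u} ∈ G) (hzu : z ≠ u) (hnk : 3 * n + 1 ≤ 2 * k)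
    (hd₁ : n / 2 ≤ (link G x z \ {x, y, z, u}).card) (hd₂ : n ≤ (link G y z \ {x, y, z, u}).card)
    (hd₃ : k + 1 ≤ degree G {x, y}) :
    Heavy G k {x, y, u} := by
  obtain ⟨hxy, hxz, hyz⟩ := ne_of_triple_mem hG hz
  obtain ⟨-, hxu, hyu⟩ := ne_of_triple_mem hG hu
  by_contra hH
  rw [Heavy, sum_powersetCard_two _ hxy hxu hyu, not_le] at hH
  have hxu' := hmin x u y (by rwa [pair_comm])
  have hyu' := hmin y u x (by rwa [insert_comm, pair_comm x u] at hu)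
  have sxy : degree G {x, y} - 2 ≤ (link G x y \ {x, y, z, u}).card :=
    degree_le_card_link_sdiff_add_two hG (a := z) (b := u) hxy (by intro; simp)
  have sxu : degree G {x, u} - 2 ≤ (link G x u \ {x, y, z, u}).card :=
    degree_le_card_link_sdiff_add_two hG (a := y) (b := z) hxu (by intro; simp; tauto)
  have syu : degree G {y, u} - 2 ≤ (link G y u \ {x, y, z, u}).card :=
    degree_le_card_link_sdiff_add_two hG (a := x) (b := z) hyu (by intro; simp; tauto)
  have key : ∃ a' b' c' e', Avoids G ![m, a', b', c', e'] ∧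
      Fits ![m, a', b', c', e'] (linkSizes G x y z u) := by
    rcases le_total (degree G {x, u}) (degree G {y, u}) with hle | hle
    · obtain ⟨h₁, h₂, h₃, h₄⟩ := codegree_bounds hk19 (by omega) (by omega) hle hH
      exact exists_fits_of_max (K := fun a b c d => Avoids G ![m, a, b, c, d])
        (fun _ _ _ _ => Avoids.swap_fst_snd) (fun _ _ _ _ => Avoids.swap_tips) hav hn hk hk19
        hxu' hle (fun h => h₄ n (by omega) (by omega) h) hnk (by omega) hd₁ hd₂
        (Or.inl ⟨sxu, syu⟩)
    · rw [add_right_comm] at hH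
      obtain ⟨h₁, h₂, h₃, h₄⟩ := codegree_bounds hk19 (by omega) (by omega) hle hH
      exact exists_fits_of_max (K := fun a b c d => Avoids G ![m, a, b, c, d])
        (fun _ _ _ _ => Avoids.swap_fst_snd) (fun _ _ _ _ => Avoids.swap_tips) hav hn hk hk19
        hyu' hle (fun h => h₄ n (by omega) (by omega) h) hnk (by omega) hd₁ hd₂
        (Or.inr ⟨sxu, syu⟩)
  obtain ⟨_, _, _, _, h₁, h₂⟩ := key
  exact h₁ x y z u hxy hxz hyz hxu hyu hzu hz hu h₂

end Heavy

section Charge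

variable {W : Type*} [DecidableEq W] {G : Finset (Finset W)} {k m n a b c e : ℕ}

lemma card_not_heavy_le (hG : ∀ g ∈ G, g.card = 3) {x y : W} (hxy : x ≠ y) (B : Finset W)
    (hB : ∀ u, {x, y, u} ∈ G → u ∉ B → Heavy G k {x, y, u}) :
    (G.filter fun f => {x, y} ⊆ f ∧ ¬ Heavy G k f).card ≤ B.card := by
  refine (card_le_card fun f hf => ?_).trans (card_image_le (s := B) (f := fun u => {x, y, u}))
  obtain ⟨hfG, hxyf, hfH⟩ := mem_filter.1 hf
  have hc : (f \ {x, y}).card = 1 := by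
    rw [card_sdiff_of_subset hxyf, hG f hfG, card_pair hxy]
  obtain ⟨u, hu⟩ := card_eq_one.1 hc
  have hf' : ({x, y, u} : Finset W) = f := by
    have := sdiff_union_of_subset hxyf
    rw [← this, hu]
    ext v; simp; tauto
  subst hf'
  refine mem_image.2 ⟨u, ?_, rfl⟩
  by_contra huB
  exact hfH (hB u hfG huB)

/-- The rate at which a heavy edge containing a pair of codegree `d` can be charged through that
pair. -/
noncomputable def chargeRate (k d : ℕ) : ℝ := ((3 : ℝ) / k - 1 / d) / (d - 1)

lemma chargeRate_nonneg {k d : ℕ} (hk : 0 < k) (hd : k ≤ 3 * d) : 0 ≤ chargeRate k d := by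
  have hd' : 0 < d := by omega
  have h₁ : (1 : ℝ) ≤ d := by exact_mod_cast hd'
  refine div_nonneg ?_ (by linarith)
  have hk' : (0 : ℝ) < k := by exact_mod_cast hk
  rw [sub_nonneg, div_le_div_iff₀ (by positivity) hk']
  exact_mod_cast (by omega : 1 * k ≤ 3 * d)

lemma mul_le_mul_chargeRate_of_le {k d r R : ℕ} {δ : ℝ} (hk : 0 < k) (hd : k ≤ 3 * d)
    (hδ : 0 ≤ δ) (hr : r ≤ R) (h : R * δ ≤ (d - R) * chargeRate k d) :
    r * δ ≤ (d - r) * chargeRate k d := by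
  have hr' : (r : ℝ) ≤ R := by exact_mod_cast hr
  have := chargeRate_nonneg hk hd
  nlinarith [mul_le_mul_of_nonneg_right hr' hδ, mul_le_mul_of_nonneg_right hr' this]

lemma le_mul_chargeRate_of_le {k d : ℕ} {δ : ℝ} (hd : 2 ≤ d) (hδ : δ ≤ 3 / k - 1 / d) :
    ((1 : ℕ) : ℝ) * δ ≤ (d - (1 : ℕ)) * chargeRate k d := by
  have h₁ : (1 : ℝ) < d := by exact_mod_cast hd
  rw [chargeRate, Nat.cast_one, mul_div_cancel₀ _ (by linarith)]
  linarith

lemma mul_le_mul_chargeRate_of_large {k d R : ℕ} {δ : ℝ} (hk : 4 ≤ k) (hR : 2 ≤ R)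
    (hd : k * R ≤ d) (hδ : R * δ ≤ 2 / k) : R * δ ≤ (d - R) * chargeRate k d := by
  have hk' : (4 : ℝ) ≤ k := by exact_mod_cast hk
  have hR' : (2 : ℝ) ≤ R := by exact_mod_cast hR
  have hd' : (k * R : ℝ) ≤ d := by exact_mod_cast hd
  have h4 : (4 : ℝ) ≤ k * R := by nlinarith
  refine hδ.trans ?_
  have h : (d - R) * chargeRate k d = (d - R) * (3 * d - k) / (k * (d * (d - 1))) := by
    have h₁ : (d : ℝ) - 1 ≠ 0 := by linarith
    have h₂ : (d : ℝ) ≠ 0 := by linarith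
    have h₃ : (k : ℝ) ≠ 0 := by linarith
    rw [chargeRate]
    field_simp
  have h₀ : (0 : ℝ) < k * (d * (d - 1)) :=
    mul_pos (by linarith) (mul_pos (by linarith) (by linarith))
  rw [h, div_le_div_iff₀ (by linarith) h₀]
  have : 2 * (d * (d - 1)) ≤ (d - R : ℝ) * (3 * d - k) := by
    have : (k + 3 * R - 2 : ℝ) ≤ d := by nlinarith [mul_nonneg (sub_nonneg.2 hk') (sub_nonneg.2 hR')]
    nlinarith
  nlinarith

lemma exists_sorted_pairs (hG : ∀ g ∈ G, g.card = 3) {f : Finset W} (hf : f ∈ G)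
    (F : Finset W → ℕ) : ∃ x y z, f = {x, y, z} ∧ F {x, y} ≤ F {x, z} ∧ F {x, z} ≤ F {y, z} := by
  obtain ⟨x, y, z, -, -, -, rfl⟩ := card_eq_three.1 (hG f hf)
  rcases le_total (F {x, y}) (F {x, z}) with h₁ | h₁ <;>
  rcases le_total (F {x, z}) (F {y, z}) with h₂ | h₂ <;>
  rcases le_total (F {x, y}) (F {y, z}) with h₃ | h₃
  · exact ⟨x, y, z, rfl, h₁, h₂⟩
  · exact ⟨x, y, z, rfl, h₁, h₂⟩
  · exact ⟨y, x, z, insert_comm _ _ _, by rwa [pair_comm y x], h₂⟩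
  · exact ⟨y, z, x, by rw [insert_comm, pair_comm x z], by rwa [pair_comm y x],
      by rwa [pair_comm y x, pair_comm z x]⟩
  · exact ⟨x, z, y, by rw [pair_comm], h₁, by rwa [pair_comm z y]⟩
  · exact ⟨z, x, y, by rw [insert_comm z x, pair_comm z y],
      by rw [pair_comm z x, pair_comm z y]; exact h₂, by rwa [pair_comm z y]⟩
  · exact ⟨z, y, x, by rw [pair_comm y x, insert_comm z x, pair_comm z y],
      by rwa [pair_comm z x, pair_comm z y], by rwa [pair_comm z x, pair_comm y x]⟩
  · exact ⟨z, y, x, by rw [pair_comm y x, insert_comm z x, pair_comm z y],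
      by rwa [pair_comm z x, pair_comm z y], by rwa [pair_comm z x, pair_comm y x]⟩

lemma light_codegree_bounds {k d₁ d₂ d₃ : ℕ} (hk : 0 < k) (h0 : 0 < d₁) (h₁₂ : d₁ ≤ d₂)
    (h₂₃ : d₂ ≤ d₃) (h : (1 : ℝ) / d₁ + 1 / d₂ + 1 / d₃ < 3 / k) :
    2 * k < 3 * d₂ ∧ k + 1 ≤ d₃ ∧
    (3 * d₁ ≤ k + 2 → k * d₁ < 2 * d₂ ∧ k * d₁ < d₃) ∧
    (3 * d₂ ≤ 2 * k + 1 → k * d₂ < d₃) := by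
  have hk' : (0 : ℝ) < k := by exact_mod_cast hk
  have h0' : (0 : ℝ) < d₁ := by exact_mod_cast h0
  have h₁₂' : (d₁ : ℝ) ≤ d₂ := by exact_mod_cast h₁₂
  have h₂₃' : (d₂ : ℝ) ≤ d₃ := by exact_mod_cast h₂₃
  have p₂ : (0 : ℝ) < d₂ := by linarith
  have p₃ : (0 : ℝ) < d₃ := by linarith
  have i₁ : 1 / (d₂ : ℝ) ≤ 1 / d₁ := one_div_le_one_div_of_le h0' h₁₂'
  have i₂ : 1 / (d₃ : ℝ) ≤ 1 / d₂ := one_div_le_one_div_of_le p₂ h₂₃'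
  have i₃ : 0 < 1 / (d₃ : ℝ) := by positivity
  refine ⟨?_, ?_, fun hs => ⟨?_, ?_⟩, fun hs => ?_⟩
  · have := lt_of_inv_add_inv_lt h0' h₁₂' hk' (by linarith)
    exact_mod_cast this
  · have : 1 / (d₃ : ℝ) < 1 / k := by
      have : (3 : ℝ) / k = 3 * (1 / k) := by ring
      linarith
    have := lt_of_one_div_lt_one_div p₃ this
    exact_mod_cast this
  · have hs' : (3 * d₁ : ℝ) ≤ k + 2 := by exact_mod_cast hs
    have e : (3 : ℝ) / k - 1 / d₁ ≤ 2 / (k * d₁) := by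
      rw [div_sub_div _ _ hk'.ne' h0'.ne', div_le_div_iff_of_pos_right (by positivity)]
      linarith
    have : 1 / (d₂ : ℝ) < 2 / (k * d₁) := by linarith
    rw [div_lt_div_iff₀ p₂ (by positivity), one_mul] at this
    exact_mod_cast this
  · have hs' : (3 * d₁ : ℝ) ≤ k + 2 := by exact_mod_cast hs
    have e : (3 : ℝ) / k - 1 / d₁ ≤ 2 / (k * d₁) := by
      rw [div_sub_div _ _ hk'.ne' h0'.ne', div_le_div_iff_of_pos_right (by positivity)]
      linarith
    have : 1 / (d₃ : ℝ) < 1 / (k * d₁) := by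
      have : (2 : ℝ) / (k * d₁) = 2 * (1 / (k * d₁)) := by ring
      linarith
    have := lt_of_one_div_lt_one_div (by positivity) this
    exact_mod_cast this
  · have hs' : (3 * d₂ : ℝ) ≤ 2 * k + 1 := by exact_mod_cast hs
    have e : (3 : ℝ) / k - 2 / d₂ ≤ 1 / (k * d₂) := by
      rw [div_sub_div _ _ hk'.ne' p₂.ne', div_le_div_iff_of_pos_right (by positivity)]
      linarith
    have : 1 / (d₃ : ℝ) < 1 / (k * d₂) := by
      have : (2 : ℝ) / d₂ = 2 * (1 / d₂) := by ring
      linarith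
    have := lt_of_one_div_lt_one_div (by positivity) this
    exact_mod_cast this

lemma mul_sub_le_two_div_of_fst {k d : ℕ} {w : ℝ} (hk : 0 < k) (hd : 0 < d)
    (h : 3 * d ≤ k + 2) (hw : 1 / d ≤ w) : d * (3 / k - w) ≤ 2 / k := by
  have hk' : (0 : ℝ) < k := by exact_mod_cast hk
  have hd' : (0 : ℝ) < d := by exact_mod_cast hd
  have h' : (3 * d : ℝ) ≤ k + 2 := by exact_mod_cast h
  calc (d : ℝ) * (3 / k - w) ≤ d * (3 / k - 1 / d) := by gcongr
    _ = (3 * d - k) / k := by field_simp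
    _ ≤ 2 / k := by gcongr; linarith

lemma mul_sub_le_two_div_of_snd {k d : ℕ} {w : ℝ} (hk : 0 < k) (hd : 0 < d)
    (h : 3 * d ≤ 2 * k + 1) (hw : 2 / d ≤ w) : d * (3 / k - w) ≤ 2 / k := by
  have hk' : (0 : ℝ) < k := by exact_mod_cast hk
  have hd' : (0 : ℝ) < d := by exact_mod_cast hd
  have h' : (3 * d : ℝ) ≤ 2 * k + 1 := by exact_mod_cast h
  calc (d : ℝ) * (3 / k - w) ≤ d * (3 / k - 2 / d) := by gcongr
    _ = (3 * d - 2 * k) / k := by field_simp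
    _ ≤ 2 / k := by gcongr; linarith

lemma card_insert_erase_link_le (hG : ∀ g ∈ G, g.card = 3) {x y z v : W} (h : {x, y, z} ∈ G) :
    (insert v ((link G x y).erase z)).card ≤ degree G {x, y} := by
  have hz := mem_link.2 h
  rw [degree_pair hG (ne_of_triple_mem hG h).1]
  refine (card_insert_le _ _).trans ?_
  rw [card_erase_add_one hz]

/-- Heaviness is forced at the pair `{y, z}` of maximum codegree when the links of the two other
pairs of `{x, y, z}` are not too small. -/
lemma heavy_of_max_of_degree (hG : ∀ g ∈ G, g.card = 3) (hav : Avoids G ![m, a, b, c, e])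
    (hn : a + b + c + e = n) (hk : m + n + 1 = k) (hk19 : 19 ≤ k)
    (hmin : ∀ x y w : W, {x, y, w} ∈ G → k + 1 ≤ 3 * degree G {x, y}) {x y z u : W}
    (hf : {y, z, x} ∈ G) (hu : {y, z, u} ∈ G) (hux : u ≠ x) (hnk : 3 * n + 1 ≤ 2 * k)
    (hd₃ : k + 1 ≤ degree G {y, z})
    (h₁ : n / 2 + 2 ≤ degree G {y, x} ∨ n / 2 + 1 ≤ degree G {y, x} ∧ u ∉ link G y x)
    (h₂ : n + 2 ≤ degree G {z, x} ∨ n + 1 ≤ degree G {z, x} ∧ u ∉ link G z x) :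
    Heavy G k {y, z, u} := by
  obtain ⟨-, hyx, hzx⟩ := ne_of_triple_mem hG hf
  refine heavy_of_max hG hav hn hk hk19 hmin hf hu hux.symm hnk ?_ ?_ hd₃
  · rcases h₁ with h | ⟨h, hb⟩
    · exact (Nat.le_sub_of_add_le h).trans
        (degree_le_card_link_sdiff_add_two hG (a := z) (b := u) hyx (by intro; simp; tauto))
    · exact (Nat.le_sub_of_add_le h).trans
        (degree_le_card_link_sdiff_add_one hG (a := z) (b := u) hyx (by intro; simp; tauto) hb)
  · rcases h₂ with h | ⟨h, hb⟩
    · exact (Nat.le_sub_of_add_le h).trans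
        (degree_le_card_link_sdiff_add_two hG (a := y) (b := u) hzx (by intro; simp; tauto))
    · exact (Nat.le_sub_of_add_le h).trans
        (degree_le_card_link_sdiff_add_one hG (a := y) (b := u) hzx (by intro; simp; tauto) hb)

/-- Every light edge contains a pair through which its deficit can be charged to the heavy edges
containing that pair. -/
lemma exists_pair_charge (hG : ∀ g ∈ G, g.card = 3) (hav : Avoids G ![m, a, b, c, e])
    (hn : a + b + c + e = n) (hk : m + n + 1 = k) (hk19 : 19 ≤ k)
    (hmin : ∀ x y w : W, {x, y, w} ∈ G → k + 1 ≤ 3 * degree G {x, y})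
    {f : Finset W} (hf : f ∈ G) (hw : weight G 3 f < 3 / k) :
    ∃ D ∈ f.powersetCard 2,
      ((G.filter fun f => D ⊆ f ∧ ¬ Heavy G k f).card : ℝ) * (3 / k - weight G 3 f) ≤
        (degree G D - (G.filter fun f => D ⊆ f ∧ ¬ Heavy G k f).card) *
          chargeRate k (degree G D) := by
  obtain ⟨x, y, z, rfl, h₁₂, h₂₃⟩ := exists_sorted_pairs hG hf (degree G)
  obtain ⟨hxy, hxz, hyz⟩ := ne_of_triple_mem hG hf
  have hf₃ : {y, z, x} ∈ G := by rwa [insert_comm, pair_comm x z] at hf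
  have hf₁ : {y, x, z} ∈ G := by rwa [insert_comm]
  have hf₂ : {z, x, y} ∈ G := by rwa [insert_comm, pair_comm z y]
  have hd₁ := hmin x y z hf
  have hwt : weight G 3 {x, y, z} = 1 / (degree G {x, y} : ℝ) + 1 / (degree G {x, z} : ℝ) +
      1 / (degree G {y, z} : ℝ) := sum_powersetCard_two _ hxy hxz hyz
  have hmem₁ : {x, y} ∈ ({x, y, z} : Finset W).powersetCard 2 :=
    mem_powersetCard.2 ⟨by intro; simp; tauto, card_pair hxy⟩
  have hmem₃ : {y, z} ∈ ({x, y, z} : Finset W).powersetCard 2 :=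
    mem_powersetCard.2 ⟨by intro; simp; tauto, card_pair hyz⟩
  have hr₁ : m + 2 ≤ degree G {x, y} → m + n / 2 + 2 ≤ degree G {x, z} → 3 * m ≤ k - 2 →
      k + 1 ≤ degree G {y, z} → (G.filter fun f => {x, y} ⊆ f ∧ ¬ Heavy G k f).card ≤ 1 :=
    fun h₁ h₂ h₃ h₄ => card_not_heavy_le hG hxy {z} fun u hu huz =>
      heavy_of_min hG hav hn hk hk19 hmin hf hu (by simpa [eq_comm] using huz) h₃ h₁ h₂ h₁₂ h₄
  have hr₂ : 3 * n + 1 ≤ 2 * k → k + 1 ≤ degree G {y, z} → n / 2 + 2 ≤ degree G {x, y} →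
      n + 2 ≤ degree G {x, z} → (G.filter fun f => {y, z} ⊆ f ∧ ¬ Heavy G k f).card ≤ 1 :=
    fun h h₃ h₁ h₂ => card_not_heavy_le hG hyz {x} fun u hu hux =>
      heavy_of_max_of_degree hG hav hn hk hk19 hmin hf₃ hu (by simpa using hux) h h₃
        (.inl (by rwa [pair_comm])) (.inl (by rwa [pair_comm]))
  have hs₁ : 3 * n + 1 ≤ 2 * k → k + 1 ≤ degree G {y, z} → n / 2 + 1 ≤ degree G {x, y} →
      n + 2 ≤ degree G {x, z} →
      (G.filter fun f => {y, z} ⊆ f ∧ ¬ Heavy G k f).card ≤ degree G {x, y} := by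
    intro h h₃ h₁ h₂
    rw [pair_comm x y]
    refine (card_not_heavy_le hG hyz _ fun u hu huB => ?_).trans
      (card_insert_erase_link_le (v := x) hG hf₁)
    have huz := (ne_of_triple_mem hG hu).2.2
    simp only [mem_insert, mem_erase, not_or, not_and] at huB
    exact heavy_of_max_of_degree hG hav hn hk hk19 hmin hf₃ hu huB.1 h h₃
      (.inr ⟨by rwa [pair_comm], huB.2 huz.symm⟩) (.inl (by rwa [pair_comm]))
  have hs₂ : 3 * n + 1 ≤ 2 * k → k + 1 ≤ degree G {y, z} → n / 2 + 2 ≤ degree G {x, y} →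
      n + 1 ≤ degree G {x, z} →
      (G.filter fun f => {y, z} ⊆ f ∧ ¬ Heavy G k f).card ≤ degree G {x, z} := by
    intro h h₃ h₁ h₂
    rw [pair_comm x z]
    refine (card_not_heavy_le hG hyz _ fun u hu huB => ?_).trans
      (card_insert_erase_link_le (v := x) hG hf₂)
    have huy := (ne_of_triple_mem hG hu).2.1
    simp only [mem_insert, mem_erase, not_or, not_and] at huB
    exact heavy_of_max_of_degree hG hav hn hk hk19 hmin hf₃ hu huB.1 h h₃
      (.inl (by rwa [pair_comm])) (.inr ⟨by rwa [pair_comm], huB.2 huy.symm⟩)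
  generalize hr : (G.filter fun f => {x, y} ⊆ f ∧ ¬ Heavy G k f).card = r at hr₁
  generalize hs : (G.filter fun f => {y, z} ⊆ f ∧ ¬ Heavy G k f).card = s at hr₂ hs₁ hs₂
  generalize hw' : weight G 3 {x, y, z} = w at *
  generalize hd₁' : degree G {x, y} = d₁ at *
  generalize hd₂' : degree G {x, z} = d₂ at *
  generalize hd₃' : degree G {y, z} = d₃ at *
  have key : (r : ℝ) * (3 / k - w) ≤ (d₁ - r) * chargeRate k d₁ ∨
      (s : ℝ) * (3 / k - w) ≤ (d₃ - s) * chargeRate k d₃ := by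
    clear hr hs hd₁' hd₂' hd₃' hw' hf hf₁ hf₂ hf₃ hmem₁ hmem₃ hxy hxz hyz hmin hG hav
    have hδ : 0 ≤ 3 / k - w := by linarith
    obtain ⟨hd₂, hd₃, hsmall₁, hsmall₂⟩ :=
      light_codegree_bounds (by omega) (by omega) h₁₂ h₂₃ (hwt ▸ hw)
    have i₁ : 0 ≤ 1 / (d₁ : ℝ) := by positivity
    have i₂ : 0 ≤ 1 / (d₂ : ℝ) := by positivity
    have i₃ : 0 ≤ 1 / (d₃ : ℝ) := by positivity
    by_cases hc₁ : m + 2 ≤ d₁ ∧ m + n / 2 + 2 ≤ d₂ ∧ 3 * m ≤ k - 2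
    · exact .inl (mul_le_mul_chargeRate_of_le (by omega) (by omega) hδ
        (hr₁ hc₁.1 hc₁.2.1 hc₁.2.2 hd₃) (le_mul_chargeRate_of_le (by omega) (by linarith)))
    right
    have hnk : 3 * n + 1 ≤ 2 * k := by omega
    by_cases hc₂ : 3 * d₁ ≤ k + 2
    · obtain ⟨hb₂, hb₃⟩ := hsmall₁ hc₂
      have h7 : k * 7 ≤ k * d₁ := Nat.mul_le_mul_left k (by omega)
      exact mul_le_mul_chargeRate_of_le (by omega) (by omega) hδ
        (hs₁ hnk hd₃ (by omega) (by omega)) (mul_le_mul_chargeRate_of_large (by omega) (by omega)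
          hb₃.le (mul_sub_le_two_div_of_fst (by omega) (by omega) hc₂ (by linarith)))
    by_cases hc₃ : n + 2 ≤ d₂
    · exact mul_le_mul_chargeRate_of_le (by omega) (by omega) hδ
        (hr₂ hnk hd₃ (by omega) hc₃) (le_mul_chargeRate_of_le (by omega) (by linarith))
    have hc₄ : 3 * d₂ ≤ 2 * k + 1 := by omega
    have i : 1 / (d₂ : ℝ) ≤ 1 / d₁ :=
      one_div_le_one_div_of_le (by exact_mod_cast (by omega : 0 < d₁)) (by exact_mod_cast h₁₂)
    have i' : 2 / (d₂ : ℝ) = 1 / d₂ + 1 / d₂ := by ring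
    exact mul_le_mul_chargeRate_of_le (by omega) (by omega) hδ
      (hs₂ hnk hd₃ (by omega) (by omega)) (mul_le_mul_chargeRate_of_large (by omega) (by omega)
        (hsmall₂ hc₄).le (mul_sub_le_two_div_of_snd (by omega) (by omega) hc₄ (by linarith)))
  rcases key with h | h
  · exact ⟨_, hmem₁, by rw [hr, hd₁']; exact h⟩
  · exact ⟨_, hmem₃, by rw [hs, hd₃']; exact h⟩

end Charge

section Discharging

variable {W : Type*} [DecidableEq W] {G : Finset (Finset W)} {k : ℕ}

lemma sum_sum_pairs_comm {A : Finset (Finset W)} (hA : A ⊆ G) (F : Finset W → Finset W → ℝ) :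
    ∑ f ∈ A, ∑ D ∈ f.powersetCard 2, F f D =
      ∑ D ∈ hshadow G 3, ∑ f ∈ A with D ⊆ f, F f D := by
  refine sum_comm' fun f D => ?_
  simp only [hshadow, mem_biUnion, mem_powersetCard, mem_filter]
  constructor
  · rintro ⟨hf, hD, hc⟩
    exact ⟨⟨hf, hD⟩, f, hA hf, hD, hc⟩
  · rintro ⟨⟨hf, hD⟩, g, -, -, hc⟩
    exact ⟨hf, hD, hc⟩

lemma degree_pos_of_mem_hshadow {D : Finset W} (hD : D ∈ hshadow G 3) : 0 < degree G D := by
  simp only [hshadow, mem_biUnion, mem_powersetCard] at hD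
  obtain ⟨f, hf, hDf, -⟩ := hD
  exact card_pos.2 ⟨f, mem_filter.2 ⟨hf, hDf⟩⟩

lemma sum_weight : ∑ f ∈ G, weight G 3 f = (hshadow G 3).card := by
  simp only [weight]
  rw [sum_sum_pairs_comm subset_rfl fun _ D => (1 : ℝ) / degree G D]
  rw [card_eq_sum_ones, Nat.cast_sum]
  refine sum_congr rfl fun D hD => ?_
  have : (degree G D : ℝ) ≠ 0 := by exact_mod_cast (degree_pos_of_mem_hshadow hD).ne'
  rw [sum_const, nsmul_eq_mul, Nat.cast_one]
  change (degree G D : ℝ) * _ = 1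
  field_simp

lemma inv_sub_chargeRate {k d : ℕ} (hk : 3 < k) (hd : 2 ≤ d) :
    1 / (d : ℝ) - chargeRate k d = (k - 3) / k * (1 / (d - 1)) := by
  have h₁ : (2 : ℝ) ≤ d := by exact_mod_cast hd
  have h₂ : (3 : ℝ) < k := by exact_mod_cast hk
  have h₃ : (d : ℝ) - 1 ≠ 0 := by linarith
  have h₄ : (d : ℝ) ≠ 0 := by linarith
  have h₅ : (k : ℝ) ≠ 0 := by linarith
  rw [chargeRate]
  field_simp
  ring

lemma Heavy.sum_chargeRate_le (hk : 5 ≤ k) (hmin : ∀ D ∈ hshadow G 3, k ≤ 3 * degree G D)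
    {f : Finset W} (hf : f ∈ G) (hH : Heavy G k f) :
    ∑ D ∈ f.powersetCard 2, chargeRate k (degree G D) ≤ weight G 3 f - 3 / k := by
  have hk' : (5 : ℝ) ≤ k := by exact_mod_cast hk
  have h : weight G 3 f - ∑ D ∈ f.powersetCard 2, chargeRate k (degree G D) =
      (k - 3) / k * ∑ D ∈ f.powersetCard 2, (1 : ℝ) / (degree G D - 1) := by
    rw [weight, ← sum_sub_distrib, mul_sum]
    refine sum_congr rfl fun D hD => inv_sub_chargeRate (by omega) ?_
    have := hmin D (mem_biUnion.2 ⟨f, hf, hD⟩)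
    omega
  have h₁ : ((k : ℝ) - 3) / k * (3 / (k - 3)) ≤ (k - 3) / k *
      ∑ D ∈ f.powersetCard 2, (1 : ℝ) / (degree G D - 1) :=
    mul_le_mul_of_nonneg_left hH (div_nonneg (by linarith) (by linarith))
  have h₂ : ((k : ℝ) - 3) / k * (3 / (k - 3)) = 3 / k := by
    have h₃ : (k : ℝ) - 3 ≠ 0 := by linarith
    have h₄ : (k : ℝ) ≠ 0 := by linarith
    field_simp
  linarith

lemma Heavy.le_weight (hk : 5 ≤ k) (hmin : ∀ D ∈ hshadow G 3, k ≤ 3 * degree G D)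
    {f : Finset W} (hf : f ∈ G) (hH : Heavy G k f) : 3 / k ≤ weight G 3 f := by
  have h₁ := hH.sum_chargeRate_le hk hmin hf
  have h₂ : 0 ≤ ∑ D ∈ f.powersetCard 2, chargeRate k (degree G D) :=
    sum_nonneg fun D hD => chargeRate_nonneg (by omega) (hmin D (mem_biUnion.2 ⟨f, hf, hD⟩))
  linarith

lemma degree_eq_heavy_add_not_heavy (k : ℕ) (D : Finset W) :
    degree G D = (G.filter fun f => Heavy G k f ∧ D ⊆ f).card +
      (G.filter fun f => D ⊆ f ∧ ¬ Heavy G k f).card := by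
  rw [degree, ← card_filter_add_card_filter_not (fun f => Heavy G k f), filter_filter,
    filter_filter]
  simp only [and_comm]

/-- If the deficit of each light edge can be charged through one of its pairs, then `G` has few
edges compared with its shadow. -/
lemma card_mul_le_card_hshadow (hk : 5 ≤ k)
    (hmin : ∀ D ∈ hshadow G 3, k ≤ 3 * degree G D)
    (hcharge : ∀ f ∈ G, weight G 3 f < 3 / k → ∃ D ∈ f.powersetCard 2,
      ((G.filter fun f => D ⊆ f ∧ ¬ Heavy G k f).card : ℝ) * (3 / k - weight G 3 f) ≤
        (degree G D - (G.filter fun f => D ⊆ f ∧ ¬ Heavy G k f).card) *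
          chargeRate k (degree G D)) :
    (G.card : ℝ) * (3 / k) ≤ (hshadow G 3).card := by
  classical
  choose! pair hpair hle using hcharge
  set L := G.filter fun f => weight G 3 f < 3 / k with hL
  set H := G.filter fun f => Heavy G k f with hH
  have hshare : ∀ D ∈ hshadow G 3, ∑ f ∈ L with pair f = D, (3 / k - weight G 3 f) ≤
      ∑ f ∈ H with D ⊆ f, chargeRate k (degree G D) := by
    intro D hD
    have hdeg : (degree G D : ℝ) - (G.filter fun f => D ⊆ f ∧ ¬ Heavy G k f).card =
        (H.filter fun f => D ⊆ f).card := by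
      rw [hH, filter_filter, degree_eq_heavy_add_not_heavy k D]
      push_cast
      ring
    have hrate := chargeRate_nonneg (k := k) (by omega) (hmin D hD)
    rw [sum_const, nsmul_eq_mul]
    rcases (L.filter fun f => pair f = D).eq_empty_or_nonempty with h | h
    · rw [h, sum_empty]
      positivity
    obtain ⟨f, hf, hmax⟩ := exists_max_image _ (fun f => 3 / (k : ℝ) - weight G 3 f) h
    obtain ⟨hfL, rfl⟩ := mem_filter.1 hf
    obtain ⟨hfG, hfl⟩ := mem_filter.1 hfL
    rw [← hdeg]
    refine le_trans ?_ (hle f hfG hfl)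
    refine (sum_le_card_nsmul _ _ _ hmax).trans ?_
    rw [nsmul_eq_mul]
    refine mul_le_mul_of_nonneg_right ?_ (by linarith)
    refine Nat.cast_le.2 (card_le_card fun g hg => ?_)
    obtain ⟨hgL, hg'⟩ := mem_filter.1 hg
    obtain ⟨hgG, hgl⟩ := mem_filter.1 hgL
    exact mem_filter.2 ⟨hgG, hg' ▸ (mem_powersetCard.1 (hpair g hgG hgl)).1,
      fun hgH => absurd (hgH.le_weight hk hmin hgG) (not_le.2 hgl)⟩
  have hlight : ∑ f ∈ L, (3 / k - weight G 3 f) ≤ ∑ f ∈ H, (weight G 3 f - 3 / k) := by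
    calc ∑ f ∈ L, (3 / k - weight G 3 f)
        = ∑ D ∈ hshadow G 3, ∑ f ∈ L with pair f = D, (3 / k - weight G 3 f) := by
          refine (sum_fiberwise_of_maps_to (fun f hf => ?_) _).symm
          obtain ⟨hfG, hfl⟩ := mem_filter.1 hf
          exact mem_biUnion.2 ⟨f, hfG, hpair f hfG hfl⟩
      _ ≤ ∑ D ∈ hshadow G 3, ∑ f ∈ H with D ⊆ f, chargeRate k (degree G D) := sum_le_sum hshare
      _ = ∑ f ∈ H, ∑ D ∈ f.powersetCard 2, chargeRate k (degree G D) :=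
          (sum_sum_pairs_comm (filter_subset _ _) fun _ D => chargeRate k (degree G D)).symm
      _ ≤ _ := sum_le_sum fun f hf =>
          (mem_filter.1 hf).2.sum_chargeRate_le hk hmin (mem_filter.1 hf).1
  have hrest : ∑ f ∈ H, (weight G 3 f - 3 / k) ≤
      ∑ f ∈ G with ¬ weight G 3 f < 3 / k, (weight G 3 f - 3 / k) := by
    refine sum_le_sum_of_subset_of_nonneg (fun f hf => ?_) fun f hf _ => ?_
    · obtain ⟨hfG, hfH⟩ := mem_filter.1 hf
      exact mem_filter.2 ⟨hfG, not_lt.2 (hfH.le_weight hk hmin hfG)⟩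
    · have := not_lt.1 (mem_filter.1 hf).2
      linarith
  have hsplit := sum_filter_add_sum_filter_not G (fun f => weight G 3 f < 3 / k)
    fun f => weight G 3 f - 3 / k
  have hneg : ∑ f ∈ L, (3 / k - weight G 3 f) = -∑ f ∈ L, (weight G 3 f - 3 / k) := by
    rw [← sum_neg_distrib]
    exact sum_congr rfl fun f _ => by ring
  rw [sum_sub_distrib (s := G), sum_weight, sum_const, nsmul_eq_mul] at hsplit
  linarith

end Discharging

lemma ContainsCopy.mono {V W : Type*} [DecidableEq V] [DecidableEq W] {G G' : Finset (Finset W)}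
    {T : Finset (Finset V)} (h : G' ⊆ G) (hc : ContainsCopy G' T) : ContainsCopy G T :=
  let ⟨f, hf, hT⟩ := hc
  ⟨f, hf, fun g hg => h (hT g hg)⟩

/-- shadow version of Theorem `two-central`. -/
theorem stmt1 {V : Type*} {W : Type*} [DecidableEq V] [DecidableEq W]
    (t : ℕ) (ht : 20 ≤ t)
    (T : Finset (Finset V)) (hTt : T.card = t)
    (hT : IsTightTree 3 T)
    (hc : ∃ T', IsTrunk 3 T T' ∧ T'.card ≤ 2)
    (G : Finset (Finset W)) (hG : ∀ g ∈ G, g.card = 3)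
    (hfree : ¬ ContainsCopy G T) :
    (G.card : ℝ) ≤ ((t : ℝ) - 1) / 3 * ((hshadow G 3).card : ℝ) := by
  obtain ⟨k, rfl⟩ : ∃ k, t = k + 1 := ⟨t - 1, by omega⟩
  obtain ⟨p, hp, hav⟩ := exists_avoids (k - 1) T (by omega) hc
  have hp' : p = ![p 0, p 1, p 2, p 3, p 4] := by
    ext j
    fin_cases j <;> rfl
  rw [Fin.sum_univ_five] at hp
  suffices h : 3 * G.card ≤ k * (hshadow G 3).card by
    have h' : (3 * G.card : ℝ) ≤ k * (hshadow G 3).card := by exact_mod_cast h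
    push_cast
    linarith
  induction hN : G.card using Nat.strong_induction_on generalizing G with
  | _ N ih =>
    subst hN
    by_cases hmin : ∀ D ∈ hshadow G 3, k + 1 ≤ 3 * degree G D
    · have hpair : ∀ x y w : W, {x, y, w} ∈ G → k + 1 ≤ 3 * degree G {x, y} := by
        refine fun x y w h => hmin _ (mem_biUnion.2 ⟨_, h, mem_powersetCard.2 ⟨?_, ?_⟩⟩)
        · intro; simp; tauto
        · exact card_pair (ne_of_triple_mem hG h).1
      have hcard := card_mul_le_card_hshadow (G := G) (k := k) (by omega)
        (fun D hD => by have := hmin D hD; omega)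
        fun f hf hw => exists_pair_charge (n := p 1 + p 2 + p 3 + p 4) hG (hp' ▸ hav G hfree)
          rfl (by omega) (by omega) hpair hf hw
      have hk : (0 : ℝ) < k := by exact_mod_cast (by omega : 0 < k)
      rw [mul_div_assoc', div_le_iff₀ hk] at hcard
      have : (3 * G.card : ℝ) ≤ k * (hshadow G 3).card := by linarith
      exact_mod_cast this
    · -- remove all edges containing a pair of small codegree
      push Not at hmin
      obtain ⟨D, hD, hdeg⟩ := hmin
      have hsub : G.filter (fun f => ¬ D ⊆ f) ⊆ G := filter_subset _ _
      have hcard : degree G D + (G.filter fun f => ¬ D ⊆ f).card = G.card :=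
        card_filter_add_card_filter_not _
      have hshadow_lt : (hshadow (G.filter fun f => ¬ D ⊆ f) 3).card < (hshadow G 3).card := by
        refine card_lt_card (Finset.ssubset_iff_subset_ne.2 ⟨biUnion_subset_biUnion_of_subset_left _ hsub,
          fun h => ?_⟩)
        rw [← h] at hD
        obtain ⟨f, hf, hDf⟩ := mem_biUnion.1 hD
        exact (mem_filter.1 hf).2 (mem_powersetCard.1 hDf).1
      have hpos := degree_pos_of_mem_hshadow hD
      have := ih _ (by omega) (G.filter fun f => ¬ D ⊆ f) (fun g hg => hG g (hsub hg))
        (fun h => hfree (h.mono hsub)) rfl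
      have := Nat.mul_le_mul_left k (Nat.succ_le_of_lt hshadow_lt)
      rw [Nat.mul_succ] at this
      omega
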